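/- Let α > 0. For each t > 0, the function ξ ↦ ρ_α(‖ξ‖, t) is continuous on K (with the inductive limit topology, i.e. the finest locally convex topology over k making all inclusions K_n → K continuous) and positive definite: for every finite family ξ₁, …, ξ_r ∈ K and c₁, …, c_r ∈ ℂ one has Σ_{i,j=1}^{r} c_i·conj(c_j)·ρ_α(‖ξ_i − ξ_j‖, t) ≥ 0. -/

import Mathlib

open MeasureTheory Module
open scoped Classical

noncomputable section

/-- The topology defined by a translation-invariant "norm" function via open balls. -/
def normTopology {X : Type} [Sub X] (f : X → ℝ) : TopologicalSpace X :=
  TopologicalSpace.generateFrom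
    {U | ∃ x : X, ∃ ε : ℝ, 0 < ε ∧ U = {y : X | f (y - x) < ε}}

variable (p : ℕ) [Fact (Nat.Prime p)]
variable (k : Type) [Field k] [Algebra ℚ_[p] k] [FiniteDimensional ℚ_[p] k]

/-- The normalized absolute value on the local field k. -/
def absk (x : k) : ℝ := ‖(Algebra.norm ℚ_[p] x : ℚ_[p])‖

/-- The topology of k as a local field. -/
def kTop : TopologicalSpace k := normTopology (absk p k)

variable (K : Type) [Field K] [Algebra k K] [CharZero K]
variable (Kn : ℕ → IntermediateField k K)

/-- The relative trace map between two intermediate fields. -/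
def relTrace (E F : IntermediateField k K) (h : E ≤ F) (x : F) : E :=
  (@Algebra.trace E F _ _ (IntermediateField.inclusion h).toRingHom.toAlgebra) x

variable (T : ℕ → K →ₗ[k] K)

/-- The projective limit K̄ of the fields Kₙ along the normalized trace maps. -/
def ProjLim : Type :=
  {x : ℕ → K // (∀ n, x n ∈ Kn n) ∧ ∀ ⦃n ν : ℕ⦄, n ≤ ν → T n (x ν) = x n}

/-- Pointwise addition on K̄. -/
def pladd (x y : ProjLim k K Kn T) : ProjLim k K Kn T :=
  ⟨fun n => x.1 n + y.1 n, by
    refine ⟨fun n => add_mem (x.2.1 n) (y.2.1 n), ?_⟩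
    intro n ν h
    simp [map_add, x.2.2 h, y.2.2 h]⟩

/-- Pointwise scalar multiplication on K̄. -/
def plsmul (c : k) (x : ProjLim k K Kn T) : ProjLim k K Kn T :=
  ⟨fun n => c • x.1 n, by
    refine ⟨fun n => (Kn n).toSubalgebra.smul_mem (x.2.1 n) c, ?_⟩
    intro n ν h
    simp [_root_.map_smul, x.2.2 h]⟩

/-- The topology on K̄ given by the seminorms x ↦ ‖xₙ‖. -/
def projTop (Knorm : K → ℝ) : TopologicalSpace (ProjLim k K Kn T) :=
  TopologicalSpace.generateFrom
    {U | ∃ x : ProjLim k K Kn T, ∃ n : ℕ, ∃ ε : ℝ, 0 < ε ∧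
          U = {y : ProjLim k K Kn T | Knorm (y.1 n - x.1 n) < ε}}

/-- The Borel σ-algebra of the seminorm topology on K̄. -/
def projMeas (Knorm : K → ℝ) : MeasurableSpace (ProjLim k K Kn T) :=
  @borel _ (projTop k K Kn T Knorm)

/-- The topology on Kₙ induced from the absolute value ‖·‖. -/
def KnTop (Knorm : K → ℝ) (n : ℕ) : TopologicalSpace (Kn n) :=
  TopologicalSpace.induced Subtype.val (normTopology Knorm)

/-- The Borel σ-algebra of Kₙ. -/
def KnMeas (Knorm : K → ℝ) (n : ℕ) : MeasurableSpace (Kn n) :=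
  @borel _ (KnTop k K Kn Knorm n)

/-- The canonical embedding of K into K̄. -/
def emb (hTmem : ∀ n x, T n x ∈ Kn n)
    (hTproj : ∀ ⦃n ν : ℕ⦄, n ≤ ν → ∀ x : K, T n (T ν x) = T n x) (x : K) :
    ProjLim k K Kn T :=
  ⟨fun n => T n x, fun n => hTmem n x, fun n ν h => hTproj h x⟩

/-- The weak topology σ(K̄, K) on K̄. -/
def weakTop (pairing : K → ProjLim k K Kn T → k) : TopologicalSpace (ProjLim k K Kn T) :=
  ⨅ a : K, TopologicalSpace.induced (pairing a) (kTop p k)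

/-- Non-archimedean seminorms on K over k. -/
def IsNASeminorm (f : K → ℝ) : Prop :=
  (∀ x, 0 ≤ f x) ∧ (∀ x y, f (x + y) ≤ max (f x) (f y)) ∧
    ∀ (c : k) (x : K), f (c • x) = absk p k c * f x

/-- The locally convex topology determined by a family of seminorms. -/
def seminormFamilyTop (F : Set (K → ℝ)) : TopologicalSpace K :=
  TopologicalSpace.generateFrom
    {U | ∃ f ∈ F, ∃ x : K, ∃ ε : ℝ, 0 < ε ∧ U = {y : K | f (y - x) < ε}}

/-- The inductive limit topology on K: the finest locally convex topology over k
making all the inclusions Kₙ → K continuous. -/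
def indTop (Knorm : K → ℝ) : TopologicalSpace K :=
  sInf {t : TopologicalSpace K |
    (∃ F : Set (K → ℝ), (∀ f ∈ F, IsNASeminorm p k K f) ∧ t = seminormFamilyTop K F) ∧
    ∀ n : ℕ, @Continuous _ _ (KnTop k K Kn Knorm n) t Subtype.val}

/-- Locally constant functions with bounded (hence compact) support on Kₙ. -/
def IsTestFun (Knorm : K → ℝ) (n : ℕ) (φ : Kn n → ℂ) : Prop :=
  @IsLocallyConstant _ _ (KnTop k K Kn Knorm n) φ ∧
    ∃ R : ℝ, ∀ ξ : Kn n, R < Knorm ↑ξ → φ ξ = 0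


/-- The fractional differentiation operator Dᵅ applied to the cylindrical function φ ∘ Tₙ. -/
def Dop (Knorm : K → ℝ) (χ : k → ℂ) (pairing : K → ProjLim k K Kn T → k)
    (vol : ∀ n : ℕ, @MeasureTheory.Measure (Kn n) (KnMeas k K Kn Knorm n))
    (μ : @MeasureTheory.Measure (ProjLim k K Kn T) (projMeas k K Kn T Knorm))
    (α : ℝ) (n : ℕ) (φ : Kn n → ℂ) (x : ProjLim k K Kn T) : ℂ :=
  ∫ ξ : Kn n,
    χ ((finrank k (Kn n) : k)⁻¹ *
        Algebra.trace k (Kn n) (-(⟨x.1 n, x.2.1 n⟩ * ξ))) *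
      (if 1 < Knorm ↑ξ then ((Knorm ↑ξ ^ α : ℝ) : ℂ) else 0) *
      (∫ y, χ (pairing (↑ξ) y) * φ ⟨y.1 n, y.2.1 n⟩ ∂μ) ∂(vol n)
end

/-- Over a complete nonarchimedean field, the norm of an element of a finite extension has absolute
value the spectral norm raised to the degree. -/
theorem norm_algebraNorm_eq_spectralNorm_pow {K L : Type*} [NontriviallyNormedField K]
    [CompleteSpace K] [IsUltrametricDist K] [Field L] [Algebra K L] [FiniteDimensional K L]
    (x : L) : ‖Algebra.norm K x‖ = spectralNorm K L x ^ finrank K L := by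
  have hx : IsIntegral K x := Algebra.IsIntegral.isIntegral x
  have hgen : ‖Algebra.norm K (IntermediateField.AdjoinSimple.gen K x)‖ =
      ‖(minpoly K x).coeff 0‖ := by
    have h := Algebra.PowerBasis.norm_gen_eq_coeff_zero_minpoly
      (IntermediateField.adjoin.powerBasis hx)
    rw [IntermediateField.adjoin.powerBasis_gen, IntermediateField.minpoly_gen] at h
    rw [h, norm_mul, norm_pow, norm_neg, norm_one, one_pow, one_mul]
  have hdeg : (minpoly K x).natDegree ≠ 0 := (minpoly.natDegree_pos hx).ne'
  have hmin : ‖(minpoly K x).coeff 0‖ = spectralNorm K L x ^ (minpoly K x).natDegree := by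
    rw [spectralNorm.spectralNorm_eq_norm_coeff_zero_rpow, one_div,
      Real.rpow_inv_natCast_pow (norm_nonneg _) hdeg]
  rw [Algebra.norm_eq_norm_adjoin, norm_pow, hgen, hmin, ← pow_mul,
    ← IntermediateField.adjoin.finrank hx, finrank_mul_finrank]

section LocalField

variable (p : ℕ) [Fact (Nat.Prime p)] (k : Type) [Field k] [Algebra ℚ_[p] k]

theorem absk_nonneg (x : k) : 0 ≤ absk p k x := norm_nonneg _

theorem absk_mul (x y : k) : absk p k (x * y) = absk p k x * absk p k y := by
  simp [absk]

theorem absk_pow (x : k) (n : ℕ) : absk p k (x ^ n) = absk p k x ^ n := by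
  simp [absk]

/-- The `[F : k]`-th root of the absolute value of the norm is nonarchimedean on a finite
extension `F` of `k`. -/
theorem absk_norm_rpow_add_le [FiniteDimensional ℚ_[p] k] (F : Type*) [Field F] [Algebra k F]
    [FiniteDimensional k F] (x y : F) :
    absk p k (Algebra.norm k (x + y)) ^ ((finrank k F : ℝ)⁻¹) ≤
      max (absk p k (Algebra.norm k x) ^ ((finrank k F : ℝ)⁻¹))
        (absk p k (Algebra.norm k y) ^ ((finrank k F : ℝ)⁻¹)) := by
  let _ : Algebra ℚ_[p] F := Algebra.compHom F (algebraMap ℚ_[p] k)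
  have _ : IsScalarTower ℚ_[p] k F := IsScalarTower.of_algebraMap_eq fun _ => rfl
  have _ : FiniteDimensional ℚ_[p] F := FiniteDimensional.trans ℚ_[p] k F
  have key (z : F) : absk p k (Algebra.norm k z) ^ ((finrank k F : ℝ)⁻¹) =
      spectralNorm ℚ_[p] F z ^ finrank ℚ_[p] k := by
    rw [absk, Algebra.norm_norm, norm_algebraNorm_eq_spectralNorm_pow,
      ← finrank_mul_finrank ℚ_[p] k F, pow_mul,
      Real.pow_rpow_inv_natCast (pow_nonneg (spectralNorm_nonneg z) _) finrank_pos.ne']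
  simp only [key]
  rcases le_max_iff.1 (isNonarchimedean_spectralNorm (K := ℚ_[p]) x y) with h | h
  · exact le_max_of_le_left (pow_le_pow_left₀ (spectralNorm_nonneg _) h _)
  · exact le_max_of_le_right (pow_le_pow_left₀ (spectralNorm_nonneg _) h _)

variable (K : Type) [Field K] [Algebra k K]

/-- The absolute value on an increasing union of finite extensions of `k` is a seminorm. -/
theorem isNASeminorm_of_eq_absk_norm_rpow [FiniteDimensional ℚ_[p] k]
    (Kn : ℕ → IntermediateField k K) (hmono : Monotone Kn)
    [hfd : ∀ n, FiniteDimensional k (Kn n)] (hunion : ∀ x : K, ∃ n, x ∈ Kn n) (Knorm : K → ℝ)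
    (hKnorm : ∀ (n : ℕ) (x : K) (hx : x ∈ Kn n),
      Knorm x = absk p k (Algebra.norm k (⟨x, hx⟩ : Kn n)) ^ ((finrank k (Kn n) : ℝ)⁻¹)) :
    IsNASeminorm p k K Knorm := by
  refine ⟨fun x => ?_, fun x y => ?_, fun c x => ?_⟩
  · obtain ⟨n, hn⟩ := hunion x
    rw [hKnorm n x hn]
    exact Real.rpow_nonneg (absk_nonneg p k _) _
  · obtain ⟨m, hm⟩ := hunion x
    obtain ⟨n, hn⟩ := hunion y
    have hx := hmono (le_max_left m n) hm
    have hy := hmono (le_max_right m n) hn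
    rw [hKnorm _ x hx, hKnorm _ y hy, hKnorm _ (x + y) (add_mem hx hy)]
    exact absk_norm_rpow_add_le p k (Kn (max m n)) ⟨x, hx⟩ ⟨y, hy⟩
  · obtain ⟨n, hn⟩ := hunion x
    have hsmul : (⟨c • x, (Kn n).smul_mem hn⟩ : Kn n) =
        algebraMap k (Kn n) c * ⟨x, hn⟩ := by
      ext
      simp [Algebra.smul_def]
    rw [hKnorm n x hn, hKnorm n (c • x) ((Kn n).smul_mem hn), hsmul, map_mul,
      Algebra.norm_algebraMap, absk_mul, absk_pow,
      Real.mul_rpow (pow_nonneg (absk_nonneg p k _) _) (absk_nonneg p k _),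
      Real.pow_rpow_inv_natCast (absk_nonneg p k _) finrank_pos.ne']

variable {p k K}

theorem IsNASeminorm.map_zero [FiniteDimensional ℚ_[p] k] {f : K → ℝ}
    (hf : IsNASeminorm p k K f) : f 0 = 0 := by
  have h := hf.2.2 0 0
  rwa [zero_smul, absk, Algebra.norm_zero, norm_zero, zero_mul] at h

theorem IsNASeminorm.map_neg {f : K → ℝ} (hf : IsNASeminorm p k K f) (x : K) : f (-x) = f x := by
  have h := hf.2.2 (-1) x
  have habs : absk p k (-1) = 1 := by
    have hsq : absk p k (-1) ^ 2 = 1 := by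
      rw [← absk_pow, neg_one_sq, absk, map_one, norm_one]
    exact (pow_eq_one_iff_of_nonneg (absk_nonneg p k _) two_ne_zero).1 hsq
  rwa [neg_one_smul, habs, one_mul] at h

theorem IsNASeminorm.map_sub_comm {f : K → ℝ} (hf : IsNASeminorm p k K f) (x y : K) :
    f (x - y) = f (y - x) := by
  rw [← neg_sub, hf.map_neg]

theorem IsNASeminorm.map_sub_le_max {f : K → ℝ} (hf : IsNASeminorm p k K f) (x y z : K) :
    f (x - z) ≤ max (f (x - y)) (f (y - z)) := by
  simpa using hf.2.1 (x - y) (y - z)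

/-- The topology of a nonarchimedean seminorm is coarser than the inductive limit of the topologies
it induces on the `Kₙ`. -/
theorem indTop_le_normTopology {Kn : ℕ → IntermediateField k K} {f : K → ℝ}
    (hf : IsNASeminorm p k K f) : indTop p k K Kn f ≤ normTopology f := by
  have h : normTopology f = seminormFamilyTop K {f} := by
    simp [normTopology, seminormFamilyTop]
  exact sInf_le ⟨⟨{f}, by simpa using hf, h⟩, fun n => continuous_induced_dom⟩

/-- A function constant on all balls of a fixed radius is continuous. -/
theorem continuous_normTopology_of_ball [FiniteDimensional ℚ_[p] k] {f : K → ℝ}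
    (hf : IsNASeminorm p k K f) {Y : Type*} [TopologicalSpace Y] {g : K → Y} {ε : ℝ} (hε : 0 < ε)
    (hg : ∀ x y, f (y - x) < ε → g y = g x) : @Continuous _ _ (normTopology f) _ g := by
  let _ := normTopology f
  refine continuous_def.2 fun U _ => isOpen_iff_forall_mem_open.2 fun x hx =>
    ⟨{y | f (y - x) < ε}, fun y hy => ?_, .basic _ ⟨x, ε, hε, rfl⟩, ?_⟩
  · rw [Set.mem_preimage, hg x y hy]
    exact hx
  · simpa [hf.map_zero] using hε

/-- A function of a nonarchimedean seminorm that is constant on `[0, 1]` is constant on balls of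
radius one. -/
theorem IsNASeminorm.comp_eq_of_sub_lt_one {f : K → ℝ} (hf : IsNASeminorm p k K f) {Y : Type*}
    {φ : ℝ → Y} {a : Y} (hφ : ∀ s ≤ 1, φ s = a) {x y : K} (hxy : f (y - x) < 1) :
    φ (f y) = φ (f x) := by
  have h₁ := hf.map_sub_le_max y x 0
  have h₂ := hf.map_sub_le_max x y 0
  rw [hf.map_sub_comm x y] at h₂
  simp only [sub_zero] at h₁ h₂
  by_cases hx : f x ≤ 1
  · rw [hφ _ hx, hφ _ (h₁.trans (max_le hxy.le hx))]
  · have hle := (le_max_iff.1 h₂).resolve_left fun h => hx (h.trans hxy.le)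
    congr 1
    exact le_antisymm (h₁.trans (max_le (by linarith) le_rfl)) hle

end LocalField

section PositiveDefinite

open ComplexConjugate

variable {ι : Type*} [Fintype ι]

theorem sum_mul_conj_ite_eq_nonneg {κ : Type*} [Fintype κ] (f : ι → κ) (c : ι → ℂ) :
    0 ≤ (∑ i, ∑ j, c i * conj (c j) * (if f i = f j then 1 else 0)).re := by
  have h : ∑ i, ∑ j, c i * conj (c j) * (if f i = f j then 1 else 0) =
      ∑ q, (∑ i, if f i = q then c i else 0) * conj (∑ i, if f i = q then c i else 0) := by
    simp_rw [map_sum, Finset.sum_mul_sum]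
    conv_rhs => rw [Finset.sum_comm]
    refine Finset.sum_congr rfl fun i _ => ?_
    conv_rhs => rw [Finset.sum_comm]
    refine Finset.sum_congr rfl fun j _ => ?_
    rw [Finset.sum_eq_single (f i)]
    · by_cases hij : f i = f j
      · simp [hij]
      · simp [hij, Ne.symm hij]
    · intro q _ hq
      simp [hq.symm]
    · simp
  rw [h, Complex.re_sum]
  refine Finset.sum_nonneg fun q _ => ?_
  rw [Complex.mul_conj, Complex.ofReal_re]
  exact Complex.normSq_nonneg _

theorem sum_mul_conj_ite_rel_nonneg {r : ι → ι → Prop} (hr : Equivalence r) (c : ι → ℂ) :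
    0 ≤ (∑ i, ∑ j, c i * conj (c j) * (if r i j then 1 else 0)).re := by
  let s : Setoid ι := ⟨r, hr⟩
  have h (i j : ι) : Quotient.mk s i = Quotient.mk s j ↔ r i j := Quotient.eq
  simpa only [h] using sum_mul_conj_ite_eq_nonneg (Quotient.mk s) c

theorem integral_Ioo_ite_lt {a : ℝ} (ha₀ : 0 ≤ a) (ha₁ : a ≤ 1) :
    ∫ s in Set.Ioo (0 : ℝ) 1, (if s < a then (1 : ℝ) else 0) = a := by
  have h : (fun s : ℝ => if s < a then (1 : ℝ) else 0) = (Set.Iio a).indicator 1 := by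
    ext s
    simp [Set.indicator_apply]
  rw [h, integral_indicator_one measurableSet_Iio, measureReal_restrict_apply measurableSet_Iio,
    Set.Iio_inter_Ioo, min_eq_left ha₁]
  simp [ha₀]

theorem integrableOn_Ioo_ite_lt (a : ℝ) :
    IntegrableOn (fun s : ℝ => if s < a then (1 : ℝ) else 0) (Set.Ioo 0 1) := by
  have h : (fun s : ℝ => if s < a then (1 : ℝ) else 0) = (Set.Iio a).indicator fun _ => 1 := by
    ext s
    simp [Set.indicator_apply]
  rw [h]
  exact (integrable_const 1).indicator measurableSet_Iio

/-- A kernel with values in `[0, 1]` all of whose strict superlevel relations are equivalences is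
positive semidefinite. -/
theorem sum_mul_conj_nonneg_of_ultrametric {g : ι → ι → ℝ} (hg₀ : ∀ i j, 0 ≤ g i j)
    (hg₁ : ∀ i j, g i j ≤ 1) (hrefl : ∀ i, g i i = 1) (hsymm : ∀ i j, g i j = g j i)
    (htrans : ∀ i j l, min (g i j) (g j l) ≤ g i l) (c : ι → ℂ) :
    0 ≤ (∑ i, ∑ j, c i * conj (c j) * (g i j : ℂ)).re := by
  have hint : (∑ i, ∑ j, c i * conj (c j) * (g i j : ℂ)).re =
      ∫ s in Set.Ioo (0 : ℝ) 1,
        ∑ i, ∑ j, (c i * conj (c j)).re * (if s < g i j then (1 : ℝ) else 0) := by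
    rw [integral_finsetSum _ fun i _ => integrable_finsetSum _ fun j _ =>
      (integrableOn_Ioo_ite_lt (g i j)).const_mul _]
    simp_rw [integral_finsetSum _ fun j _ => (integrableOn_Ioo_ite_lt (g _ j)).const_mul _,
      integral_const_mul, integral_Ioo_ite_lt (hg₀ _ _) (hg₁ _ _), Complex.re_sum,
      Complex.re_mul_ofReal]
  rw [hint]
  refine setIntegral_nonneg measurableSet_Ioo fun s hs => ?_
  have heq : Equivalence fun i j => s < g i j :=
    ⟨fun i => (hrefl i).symm ▸ hs.2, fun {i j} h => hsymm i j ▸ h,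
      fun {i j l} h₁ h₂ => (lt_min h₁ h₂).trans_le (htrans i j l)⟩
  refine (sum_mul_conj_ite_rel_nonneg heq c).trans_eq ?_
  simp only [Complex.re_sum]
  refine Finset.sum_congr rfl fun i _ => Finset.sum_congr rfl fun j _ => ?_
  split_ifs <;> simp

theorem im_sum_mul_conj_eq_zero {g : ι → ι → ℝ} (hsymm : ∀ i j, g i j = g j i) (c : ι → ℂ) :
    (∑ i, ∑ j, c i * conj (c j) * (g i j : ℂ)).im = 0 := by
  rw [← Complex.conj_eq_iff_im]
  simp_rw [map_sum, map_mul, Complex.conj_conj, Complex.conj_ofReal]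
  rw [Finset.sum_comm]
  refine Finset.sum_congr rfl fun i _ => Finset.sum_congr rfl fun j _ => ?_
  rw [hsymm j i, mul_comm (conj (c j))]

end PositiveDefinite

section Rho

variable {α t : ℝ}

theorem ite_exp_neg_rpow_nonneg (s : ℝ) :
    0 ≤ if s ≤ 1 then (1 : ℝ) else Real.exp (-t * s ^ α) := by
  split_ifs <;> positivity

theorem ite_exp_neg_rpow_le_one (ht : 0 < t) (s : ℝ) :
    (if s ≤ 1 then (1 : ℝ) else Real.exp (-t * s ^ α)) ≤ 1 := by
  split_ifs with h
  · exact le_rfl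
  · have hs : 0 ≤ s ^ α := Real.rpow_nonneg (by linarith) α
    exact Real.exp_le_one_iff.2 (by nlinarith)

theorem antitone_ite_exp_neg_rpow (hα : 0 < α) (ht : 0 < t) :
    Antitone fun s : ℝ => if s ≤ 1 then (1 : ℝ) else Real.exp (-t * s ^ α) := by
  intro a b hab
  by_cases ha : a ≤ 1
  · simpa only [if_pos ha] using ite_exp_neg_rpow_le_one ht b
  · have hb : ¬ b ≤ 1 := fun h => ha (hab.trans h)
    simp only [if_neg ha, if_neg hb]
    have hpow : a ^ α ≤ b ^ α := Real.rpow_le_rpow (by linarith) hab hα.le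
    exact Real.exp_le_exp.2 (by nlinarith)

end Rho

theorem statement_18
    (p : ℕ) [Fact (Nat.Prime p)]
    (k : Type) [Field k] [Algebra ℚ_[p] k] [FiniteDimensional ℚ_[p] k]
    (K : Type) [Field K] [Algebra k K] [CharZero K]
    (Kn : ℕ → IntermediateField k K)
    (hbot : Kn 1 = ⊥) (hmono : Monotone Kn)
    [hfd : ∀ n, FiniteDimensional k (Kn n)]
    (hunion : ∀ x : K, ∃ n, x ∈ Kn n)
    (T : ℕ → K →ₗ[k] K)
    (hTmem : ∀ (n : ℕ) (x : K), T n x ∈ Kn n)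
    (hTdef : ∀ (n ν : ℕ) (h : n ≤ ν) (x : K) (hx : x ∈ Kn ν),
      T n x = ((finrank k (Kn n) : K) / (finrank k (Kn ν) : K)) *
        (relTrace k K (Kn n) (Kn ν) (hmono h) ⟨x, hx⟩ : K))
    (Knorm : K → ℝ)
    (hKnorm : ∀ (n : ℕ) (x : K) (hx : x ∈ Kn n),
      Knorm x = absk p k (Algebra.norm k (⟨x, hx⟩ : Kn n)) ^ ((finrank k (Kn n) : ℝ)⁻¹))
    (α : ℝ) (hα : 0 < α) (t : ℝ) (ht : 0 < t) :
    @Continuous _ _ (indTop p k K Kn Knorm) _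
      (fun ξ : K => if Knorm ξ ≤ 1 then (1 : ℝ) else Real.exp (-t * Knorm ξ ^ α)) ∧
    ∀ (r : ℕ) (ξ : Fin r → K) (c : Fin r → ℂ),
      0 ≤ (∑ i, ∑ j, c i * (starRingEnd ℂ) (c j) *
            (((if Knorm (ξ i - ξ j) ≤ 1 then (1 : ℝ)
                else Real.exp (-t * Knorm (ξ i - ξ j) ^ α)) : ℝ) : ℂ)).re ∧
        (∑ i, ∑ j, c i * (starRingEnd ℂ) (c j) *
            (((if Knorm (ξ i - ξ j) ≤ 1 then (1 : ℝ)
                else Real.exp (-t * Knorm (ξ i - ξ j) ^ α)) : ℝ) : ℂ)).im = 0 := by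
  have hf := isNASeminorm_of_eq_absk_norm_rpow p k K Kn hmono hunion Knorm hKnorm
  have hanti := antitone_ite_exp_neg_rpow hα ht
  refine ⟨?_, fun r ξ c => ⟨?_, ?_⟩⟩
  · exact continuous_le_dom (indTop_le_normTopology hf)
      (continuous_normTopology_of_ball hf one_pos fun x y hxy =>
        hf.comp_eq_of_sub_lt_one
          (φ := fun s => if s ≤ 1 then (1 : ℝ) else Real.exp (-t * s ^ α)) (a := 1)
          (fun s hs => if_pos hs) hxy)
  · refine sum_mul_conj_nonneg_of_ultrametric (fun i j => ite_exp_neg_rpow_nonneg _)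
      (fun i j => ite_exp_neg_rpow_le_one ht _) (fun i => ?_) (fun i j => ?_)
      (fun i j l => ?_) c
    · rw [sub_self, hf.map_zero, if_pos zero_le_one]
    · rw [hf.map_sub_comm]
    · exact hanti.map_max.symm.le.trans (hanti (hf.map_sub_le_max (ξ i) (ξ j) (ξ l)))
  · refine im_sum_mul_conj_eq_zero (fun i j => ?_) c
    rw [hf.map_sub_comm]
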